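/- arXiv:1105.0569 — 4 statements merged into one kernel-verified Lean document; each statement's English description precedes it below -/
import Mathlib

section
/- The system of implicit equations ḡ_k = (1/N)·tr( P_k ( g_k P_k + (c̄_k − g_k ḡ_k) I_{n_k} )^{-1} ), g_k = (1/N)·Σ_{j=1}^{N_k} δ_{kj}/(1 + ḡ_k δ_{kj}), δ_{kj} = (1/N)·tr( R_{kj} ( (1/N)·Σ_{l=1}^{K} Σ_{m=1}^{N_l} ḡ_l R_{lm}/(1 + ḡ_l δ_{lm}) + ρ I_N )^{-1} ), for k ∈ {1,…,K} and j ∈ {1,…,N_k}, has a unique solution (ḡ_1,…,ḡ_K, g_1,…,g_K, (δ_{kj})_{k,j}) satisfying δ_{kj} ≥ 0 for all k,j, g_k ≥ 0 for all k, and 0 ≤ ḡ_k with g_k ḡ_k < c_k c̄_k for all k. -/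
open Matrix
open scoped ComplexOrder

section PosDefInverse

variable {n : Type*} [Fintype n] [DecidableEq n]

lemma posDef_inv_sub_inv_eq {X Y : Matrix n n ℂ} (hX : X.PosDef) (hY : Y.PosDef) :
    X⁻¹ - Y⁻¹ = (Y⁻¹)ᴴ * ((Y - X) + (Y - X)ᴴ * X⁻¹ * (Y - X)) * Y⁻¹ := by
  have hXu := (Matrix.isUnit_iff_isUnit_det X).mp hX.isUnit
  have hYu := (Matrix.isUnit_iff_isUnit_det Y).mp hY.isUnit
  have hD : (Y - X)ᴴ = Y - X := (hY.isHermitian.sub hX.isHermitian).eq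
  have hYi : (Y⁻¹)ᴴ = Y⁻¹ := hY.inv.isHermitian.eq
  have key : (Y - X) + (Y - X) * X⁻¹ * (Y - X) = Y * (X⁻¹ - Y⁻¹) * Y := by
    simp only [mul_sub, sub_mul, Matrix.mul_nonsing_inv X hXu, Matrix.mul_nonsing_inv Y hYu,
      one_mul]
    rw [mul_assoc Y X⁻¹ X, Matrix.nonsing_inv_mul X hXu]
    simp
  rw [hD, hYi, key]
  simp only [← mul_assoc, Matrix.nonsing_inv_mul Y hYu, one_mul]
  rw [mul_assoc, Matrix.mul_nonsing_inv Y hYu, mul_one]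

lemma posSemidef_inv_sub_inv {X Y : Matrix n n ℂ} (hX : X.PosDef) (hY : Y.PosDef)
    (h : (Y - X).PosSemidef) : (X⁻¹ - Y⁻¹).PosSemidef := by
  rw [posDef_inv_sub_inv_eq hX hY]
  exact (h.add (hX.inv.posSemidef.conjTranspose_mul_mul_same _)).conjTranspose_mul_mul_same _

lemma posDef_inv_sub_inv {X Y : Matrix n n ℂ} (hX : X.PosDef) (hY : Y.PosDef)
    (h : (Y - X).PosDef) : (X⁻¹ - Y⁻¹).PosDef := by
  rw [posDef_inv_sub_inv_eq hX hY]
  exact (h.add_posSemidef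
    (hX.inv.posSemidef.conjTranspose_mul_mul_same _)).conjTranspose_mul_mul_same
      (Matrix.mulVec_injective_of_isUnit hY.inv.isUnit)

open scoped MatrixOrder in
lemma trace_mul_nonneg_of_posSemidef {A B : Matrix n n ℂ} (hA : A.PosSemidef)
    (hB : B.PosSemidef) : 0 ≤ (A * B).trace := by
  obtain ⟨C, rfl⟩ := CStarAlgebra.nonneg_iff_eq_star_mul_self.mp hA.nonneg
  rw [Matrix.star_eq_conjTranspose, mul_assoc, Matrix.trace_mul_comm]
  exact (hB.mul_mul_conjTranspose_same C).trace_nonneg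

open scoped MatrixOrder in
lemma trace_mul_pos_of_posDef {A B : Matrix n n ℂ} (hA : A.PosSemidef) (hA0 : A ≠ 0)
    (hB : B.PosDef) : 0 < (A * B).trace := by
  refine lt_of_le_of_ne (trace_mul_nonneg_of_posSemidef hA hB.posSemidef) fun h ↦ hA0 ?_
  obtain ⟨E, rfl⟩ := CStarAlgebra.nonneg_iff_eq_star_mul_self.mp hB.posSemidef.nonneg
  have hE : IsUnit E := by
    have := (Matrix.isUnit_iff_isUnit_det _).mp hB.isUnit
    rw [Matrix.det_mul] at this
    exact (Matrix.isUnit_iff_isUnit_det _).mpr (isUnit_of_mul_isUnit_right this)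
  rw [Matrix.star_eq_conjTranspose, ← mul_assoc, Matrix.trace_mul_comm, ← mul_assoc] at h
  have h0 := (hA.mul_mul_conjTranspose_same E).trace_eq_zero_iff.mp h.symm
  have hE' : IsUnit Eᴴ := (Matrix.isUnit_conjTranspose E).mpr hE
  exact hE.mul_right_eq_zero.mp (hE'.mul_left_eq_zero.mp h0)

end PosDefInverse

section RegularizedSum

variable {n : Type*} {κ : Type*} [Fintype κ] {ι : κ → Type*}
  [∀ k, Fintype (ι k)]

variable {ν ρ : ℝ} {R : (k : κ) → ι k → Matrix n n ℂ} {a b : (k : κ) → ι k → ℝ}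

lemma posSemidef_weightedSum (hR : ∀ k j, (R k j).PosSemidef) (ha : 0 ≤ a) :
    (∑ l, ∑ m, (a l m : ℂ) • R l m).PosSemidef :=
  Matrix.posSemidef_sum _ fun l _ ↦ Matrix.posSemidef_sum _ fun m _ ↦
    (hR l m).smul (Complex.zero_le_real.mpr (ha l m))

variable [DecidableEq n]

/-- The regularized weighted sum `ν ∑ a R + ρ I`. -/
def regularizedSum (ν ρ : ℝ) (R : (k : κ) → ι k → Matrix n n ℂ) (a : (k : κ) → ι k → ℝ) :
    Matrix n n ℂ :=
  (ν : ℂ) • (∑ l, ∑ m, (a l m : ℂ) • R l m) + (ρ : ℂ) • (1 : Matrix n n ℂ)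

lemma posDef_regularizedSum (hν : 0 ≤ ν) (hρ : 0 < ρ) (hR : ∀ k j, (R k j).PosSemidef)
    (ha : 0 ≤ a) : (regularizedSum ν ρ R a).PosDef :=
  ((Matrix.PosDef.one).smul (Complex.zero_lt_real.mpr hρ)).posSemidef_add
    ((posSemidef_weightedSum hR ha).smul (Complex.zero_le_real.mpr hν))

lemma smul_regularizedSum_sub (α : ℝ) :
    (α : ℂ) • regularizedSum ν ρ R b - regularizedSum ν ρ R a =
      regularizedSum ν ((α - 1) * ρ) R (α • b - a) := by
  simp only [regularizedSum, Pi.sub_apply, Pi.smul_apply, smul_eq_mul, Complex.ofReal_sub,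
    Complex.ofReal_mul, Complex.ofReal_one, sub_smul, mul_smul, Finset.sum_sub_distrib,
    ← Finset.smul_sum, smul_add, smul_sub]
  rw [smul_comm (α : ℂ) (ν : ℂ)]
  module

variable [Fintype n] {S : Matrix n n ℂ}

/-- The real part of `ν tr (S (ν ∑ a R + ρ I)⁻¹)`. -/
noncomputable def resolventTrace (ν ρ : ℝ) (R : (k : κ) → ι k → Matrix n n ℂ) (S : Matrix n n ℂ)
    (a : (k : κ) → ι k → ℝ) : ℝ :=
  ((ν : ℂ) * (S * (regularizedSum ν ρ R a)⁻¹).trace).re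

lemma ofReal_resolventTrace (hν : 0 ≤ ν) (hρ : 0 < ρ) (hR : ∀ k j, (R k j).PosSemidef)
    (hS : S.PosSemidef) (ha : 0 ≤ a) :
    (resolventTrace ν ρ R S a : ℂ) = (ν : ℂ) * (S * (regularizedSum ν ρ R a)⁻¹).trace := by
  have h := trace_mul_nonneg_of_posSemidef hS (posDef_regularizedSum hν hρ hR ha).inv.posSemidef
  exact (Complex.eq_re_of_ofReal_le (r := 0)
    (by simpa using mul_nonneg (Complex.zero_le_real.mpr hν) h)).symm

lemma resolventTrace_nonneg (hν : 0 ≤ ν) (hρ : 0 < ρ) (hR : ∀ k j, (R k j).PosSemidef)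
    (hS : S.PosSemidef) (ha : 0 ≤ a) : 0 ≤ resolventTrace ν ρ R S a := by
  rw [← Complex.zero_le_real, ofReal_resolventTrace hν hρ hR hS ha]
  exact mul_nonneg (Complex.zero_le_real.mpr hν)
    (trace_mul_nonneg_of_posSemidef hS (posDef_regularizedSum hν hρ hR ha).inv.posSemidef)

lemma resolventTrace_eq_zero_iff (hν : 0 < ν) (hρ : 0 < ρ) (hR : ∀ k j, (R k j).PosSemidef)
    (hS : S.PosSemidef) (ha : 0 ≤ a) : resolventTrace ν ρ R S a = 0 ↔ S = 0 := by
  refine ⟨fun h ↦ by_contra fun hS0 ↦ ?_, fun h ↦ by simp [resolventTrace, h]⟩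
  have h1 := ofReal_resolventTrace hν.le hρ hR hS ha
  have h2 := mul_pos (Complex.zero_lt_real.mpr hν)
    (trace_mul_pos_of_posDef hS hS0 (posDef_regularizedSum hν.le hρ hR ha).inv)
  rw [← h1, h] at h2
  simp at h2

lemma resolventTrace_antitone (hν : 0 ≤ ν) (hρ : 0 < ρ) (hR : ∀ k j, (R k j).PosSemidef)
    (hS : S.PosSemidef) (ha : 0 ≤ a) (hab : a ≤ b) :
    resolventTrace ν ρ R S b ≤ resolventTrace ν ρ R S a := by
  have hb := ha.trans hab
  have hD : (regularizedSum ν ρ R b - regularizedSum ν ρ R a).PosSemidef := by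
    have := smul_regularizedSum_sub (ν := ν) (ρ := ρ) (R := R) (a := a) (b := b) 1
    simp only [Complex.ofReal_one, one_smul, sub_self, zero_mul] at this
    rw [this]
    simpa [regularizedSum] using (posSemidef_weightedSum hR (sub_nonneg.mpr hab)).smul
      (Complex.zero_le_real.mpr hν)
  have h := trace_mul_nonneg_of_posSemidef hS (posSemidef_inv_sub_inv
    (posDef_regularizedSum hν hρ hR ha) (posDef_regularizedSum hν hρ hR hb) hD)
  rw [mul_sub, Matrix.trace_sub, sub_nonneg] at h
  rw [← Complex.real_le_real, ofReal_resolventTrace hν hρ hR hS ha,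
    ofReal_resolventTrace hν hρ hR hS hb]
  exact mul_le_mul_of_nonneg_left h (Complex.zero_le_real.mpr hν)

lemma resolventTrace_lt_mul (hν : 0 < ν) (hρ : 0 < ρ) (hR : ∀ k j, (R k j).PosSemidef)
    (hS : S.PosSemidef) (hS0 : S ≠ 0) (ha : 0 ≤ a) (hb : 0 ≤ b) {α : ℝ} (hα : 1 < α)
    (hab : a ≤ α • b) :
    resolventTrace ν ρ R S b < α * resolventTrace ν ρ R S a := by
  have hα0 : 0 < α := by linarith
  have hαC : (α : ℂ) ≠ 0 := by exact_mod_cast hα0.ne'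
  have hB := posDef_regularizedSum hν.le hρ hR hb
  have hD : ((α : ℂ) • regularizedSum ν ρ R b - regularizedSum ν ρ R a).PosDef := by
    rw [smul_regularizedSum_sub]
    exact posDef_regularizedSum hν.le (mul_pos (by linarith) hρ) hR (sub_nonneg.mpr hab)
  have h := trace_mul_pos_of_posDef hS hS0 (posDef_inv_sub_inv
    (posDef_regularizedSum hν.le hρ hR ha) (hB.smul (Complex.zero_lt_real.mpr hα0)) hD)
  have hinv : ((α : ℂ) • regularizedSum ν ρ R b)⁻¹ =
      (α : ℂ)⁻¹ • (regularizedSum ν ρ R b)⁻¹ := by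
    refine Matrix.inv_eq_left_inv ?_
    rw [smul_mul_smul_comm, inv_mul_cancel₀ hαC, one_smul,
      Matrix.nonsing_inv_mul _ ((Matrix.isUnit_iff_isUnit_det _).mp hB.isUnit)]
  rw [hinv, mul_sub, Matrix.trace_sub, Matrix.mul_smul, Matrix.trace_smul, smul_eq_mul] at h
  have h2 := mul_pos (Complex.zero_lt_real.mpr hν) h
  have h3 : (ν : ℂ) * ((S * (regularizedSum ν ρ R a)⁻¹).trace -
      (α : ℂ)⁻¹ * (S * (regularizedSum ν ρ R b)⁻¹).trace) =
      ((resolventTrace ν ρ R S a - α⁻¹ * resolventTrace ν ρ R S b : ℝ) : ℂ) := by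
    push_cast
    rw [ofReal_resolventTrace hν.le hρ hR hS ha, ofReal_resolventTrace hν.le hρ hR hS hb]
    ring
  rw [h3, Complex.zero_lt_real, sub_pos, inv_mul_lt_iff₀ hα0] at h2
  exact h2

end RegularizedSum

section ScalarResolvent

variable {μ : Type*} [Fintype μ]

/-- The sum `∑ 1 / (1 + p z)`. -/
noncomputable def invSum (p : μ → ℝ) (z : ℝ) : ℝ := ∑ i, 1 / (1 + p i * z)

/-- The sum `∑ p / (1 + p z)`. -/
noncomputable def weightedInvSum (p : μ → ℝ) (z : ℝ) : ℝ := ∑ i, p i / (1 + p i * z)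

/-- The mean of `p` with respect to the weights `1 / (1 + p z)`. -/
noncomputable def weightedMean (p : μ → ℝ) (z : ℝ) : ℝ := weightedInvSum p z / invSum p z

variable {p : μ → ℝ} {z w : ℝ}

lemma invSum_pos [Nonempty μ] (hp : 0 ≤ p) (hz : 0 ≤ z) : 0 < invSum p z :=
  Finset.sum_pos (fun i _ ↦ by have := mul_nonneg (hp i) hz; positivity) Finset.univ_nonempty

lemma weightedInvSum_nonneg (hp : 0 ≤ p) (hz : 0 ≤ z) : 0 ≤ weightedInvSum p z :=
  Finset.sum_nonneg fun i _ ↦ div_nonneg (hp i) (by have := mul_nonneg (hp i) hz; positivity)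

lemma weightedInvSum_eq_zero_iff (hp : 0 ≤ p) (hz : 0 ≤ z) : weightedInvSum p z = 0 ↔ p = 0 := by
  have h1 : ∀ i, 0 < 1 + p i * z := fun i ↦ by have := mul_nonneg (hp i) hz; positivity
  rw [weightedInvSum, Finset.sum_eq_zero_iff_of_nonneg fun i _ ↦ div_nonneg (hp i) (h1 i).le]
  simp [funext_iff, (h1 _).ne']

lemma weightedMean_nonneg [Nonempty μ] (hp : 0 ≤ p) (hz : 0 ≤ z) : 0 ≤ weightedMean p z :=
  div_nonneg (weightedInvSum_nonneg hp hz) (invSum_pos hp hz).le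

lemma weightedMean_eq_zero_iff [Nonempty μ] (hp : 0 ≤ p) (hz : 0 ≤ z) :
    weightedMean p z = 0 ↔ p = 0 := by
  rw [weightedMean, div_eq_zero_iff, or_iff_left (invSum_pos hp hz).ne',
    weightedInvSum_eq_zero_iff hp hz]

lemma invSum_add_mul_weightedInvSum (hp : 0 ≤ p) (hz : 0 ≤ z) :
    invSum p z + z * weightedInvSum p z = Fintype.card μ := by
  rw [invSum, weightedInvSum, Finset.mul_sum, ← Finset.sum_add_distrib]
  have : ∀ i ∈ Finset.univ, 1 / (1 + p i * z) + z * (p i / (1 + p i * z)) = 1 := fun i _ ↦ by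
    have : 0 < 1 + p i * z := by have := mul_nonneg (hp i) hz; positivity
    field_simp
  rw [Finset.sum_congr rfl this]
  simp

lemma invSum_antitone (hp : 0 ≤ p) (hz : 0 ≤ z) (hzw : z ≤ w) : invSum p w ≤ invSum p z := by
  refine Finset.sum_le_sum fun i _ ↦ ?_
  have h1 := mul_nonneg (hp i) hz
  have h2 := mul_le_mul_of_nonneg_left hzw (hp i)
  gcongr

lemma mul_weightedInvSum_monotone (hp : 0 ≤ p) (hz : 0 ≤ z) (hzw : z ≤ w) :
    z * weightedInvSum p z ≤ w * weightedInvSum p w := by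
  linarith [invSum_add_mul_weightedInvSum hp hz, invSum_antitone hp hz hzw,
    invSum_add_mul_weightedInvSum hp (hz.trans hzw)]

lemma mul_invSum_strictMono [Nonempty μ] (hp : 0 ≤ p) (hz : 0 ≤ z) (hzw : z < w) :
    z * invSum p z < w * invSum p w := by
  rw [invSum, invSum, Finset.mul_sum, Finset.mul_sum]
  refine Finset.sum_lt_sum_of_nonempty Finset.univ_nonempty fun i _ ↦ ?_
  have h1 := mul_nonneg (hp i) hz
  have h2 := mul_nonneg (hp i) (hz.trans hzw.le)
  rw [mul_one_div, mul_one_div, div_lt_div_iff₀ (by linarith) (by linarith)]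
  linarith [mul_comm z (p i * w), mul_comm w (p i * z), mul_right_comm (p i) w z]

lemma weightedMean_antitone [Nonempty μ] (hp : 0 ≤ p) (hz : 0 ≤ z) (hzw : z ≤ w) :
    weightedMean p w ≤ weightedMean p z := by
  have hw := hz.trans hzw
  rw [weightedMean, weightedMean, div_le_div_iff₀ (invSum_pos hp hw) (invSum_pos hp hz),
    ← sub_nonneg]
  set f : μ → μ → ℝ := fun i j ↦
    p i / (1 + p i * z) * (1 / (1 + p j * w)) - p i / (1 + p i * w) * (1 / (1 + p j * z))
  have hf : weightedInvSum p z * invSum p w - weightedInvSum p w * invSum p z =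
      ∑ i, ∑ j, f i j := by
    simp only [f, Finset.sum_sub_distrib, invSum, weightedInvSum, Finset.sum_mul_sum]
  have hsym : ∑ i, ∑ j, f i j = ∑ i, ∑ j, f j i := Finset.sum_comm
  have hnonneg : 0 ≤ ∑ i, ∑ j, (f i j + f j i) := by
    refine Finset.sum_nonneg fun i _ ↦ Finset.sum_nonneg fun j _ ↦ ?_
    have hiz : 0 < 1 + p i * z := by have := mul_nonneg (hp i) hz; positivity
    have hiw : 0 < 1 + p i * w := by have := mul_nonneg (hp i) hw; positivity
    have hjz : 0 < 1 + p j * z := by have := mul_nonneg (hp j) hz; positivity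
    have hjw : 0 < 1 + p j * w := by have := mul_nonneg (hp j) hw; positivity
    have : f i j + f j i = (p i - p j) ^ 2 * (w - z) /
        ((1 + p i * z) * (1 + p i * w) * (1 + p j * z) * (1 + p j * w)) := by
      simp only [f]
      rw [eq_div_iff (by positivity)]
      generalize hA : 1 + p i * z = A at *
      generalize hB : 1 + p i * w = B at *
      generalize hC : 1 + p j * z = C at *
      generalize hE : 1 + p j * w = E at *
      field_simp
      rw [← hA, ← hB, ← hC, ← hE]
      ring
    rw [this]
    exact div_nonneg (mul_nonneg (sq_nonneg _) (sub_nonneg.mpr hzw)) (by positivity)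
  simp only [Finset.sum_add_distrib] at hnonneg
  linarith

/-- Along the curve `z ↦ (z * invSum p z, weightedMean p z)`, an increase of the first coordinate
by a factor less than `α` decreases the second one by a factor less than `α`. -/
lemma weightedMean_lt_mul [Nonempty μ] (hp : 0 ≤ p) (hp0 : p ≠ 0) (hz : 0 ≤ z) (hw : 0 ≤ w)
    {α : ℝ} (hα : 1 < α) (h0 : z * invSum p z = 0 → w * invSum p w = 0)
    (h : 0 < z * invSum p z → w * invSum p w < α * (z * invSum p z)) :
    weightedMean p z < α * weightedMean p w := by
  have hpos : ∀ {x : ℝ}, 0 ≤ x → 0 < weightedMean p x := fun hx ↦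
    (weightedMean_nonneg hp hx).lt_of_ne' (mt (weightedMean_eq_zero_iff hp hx).mp hp0)
  rcases le_or_gt w z with hwz | hzw
  · nlinarith [weightedMean_antitone hp hw hwz, hpos hw]
  · have hs := mul_invSum_strictMono hp hz hzw
    have hz0 : 0 < z * invSum p z := by
      refine (mul_nonneg hz (invSum_pos hp hz).le).lt_of_ne' fun h1 ↦ ?_
      rw [h1, h0 h1] at hs
      exact hs.false
    have hx := mul_weightedInvSum_monotone hp hz hzw.le
    have e : ∀ {x : ℝ}, 0 ≤ x → x * weightedInvSum p x = weightedMean p x * (x * invSum p x) :=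
      fun {x} hx ↦ by
        have := (invSum_pos hp hx).ne'
        rw [weightedMean]
        field_simp
    rw [e hz, e hw] at hx
    have h2 : weightedMean p w * (w * invSum p w) <
        weightedMean p w * (α * (z * invSum p z)) := mul_lt_mul_of_pos_left (h hz0) (hpos hw)
    refine lt_of_mul_lt_mul_right (a := z * invSum p z) ?_ hz0.le
    linarith

lemma exists_eq_weightedMean [Nonempty μ] (hp : 0 ≤ p) {ν g gb : ℝ} (hν : 0 < ν) (hg : 0 ≤ g)
    (ht : g * gb < ν * Fintype.card μ)
    (hgb : gb = ν * ∑ i, p i / (g * p i + (ν * Fintype.card μ - g * gb))) :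
    ∃ z, 0 ≤ z ∧ gb = weightedMean p z ∧ g = ν * (z * invSum p z) := by
  set t := ν * Fintype.card μ - g * gb with ht_def
  have ht0 : 0 < t := sub_pos.mpr ht
  have hz : 0 ≤ g / t := div_nonneg hg ht0.le
  have hgz : g / t * t = g := div_mul_cancel₀ _ ht0.ne'
  have hsum : gb * t = ν * weightedInvSum p (g / t) := by
    rw [hgb, weightedInvSum, mul_assoc, Finset.sum_mul]
    congr 1
    refine Finset.sum_congr rfl fun i _ ↦ ?_
    have : 0 < g * p i + t := by have := mul_nonneg hg (hp i); positivity
    have : 0 < 1 + p i * (g / t) := by have := mul_nonneg (hp i) hz; positivity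
    field_simp
    ring
  have hinv : t = ν * invSum p (g / t) := by
    have h := invSum_add_mul_weightedInvSum hp hz
    have : g * gb = ν * (g / t * weightedInvSum p (g / t)) := by
      rw [mul_left_comm, ← hsum]
      field_simp
    linear_combination ht_def - this - ν * h
  have hA := invSum_pos hp hz
  refine ⟨g / t, hz, ?_, ?_⟩
  · rw [weightedMean, eq_div_iff hA.ne']
    refine mul_left_cancel₀ hν.ne' ?_
    rw [← hsum, mul_left_comm, ← hinv]
  · rw [mul_left_comm, ← hinv, hgz]

lemma weightedMean_eq_sum [Nonempty μ] (hp : 0 ≤ p) {ν : ℝ} (hν : 0 < ν) (hz : 0 ≤ z) :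
    ν * (z * invSum p z) * weightedMean p z < ν * Fintype.card μ ∧
    weightedMean p z = ν * ∑ i, p i / (ν * (z * invSum p z) * p i +
      (ν * Fintype.card μ - ν * (z * invSum p z) * weightedMean p z)) := by
  have hA := invSum_pos hp hz
  have h := invSum_add_mul_weightedInvSum hp hz
  have ht : ν * Fintype.card μ - ν * (z * invSum p z) * weightedMean p z = ν * invSum p z := by
    rw [← h, weightedMean]
    field_simp
    ring
  refine ⟨by linarith [mul_pos hν hA], ?_⟩
  rw [ht, weightedMean, weightedInvSum, Finset.mul_sum, Finset.sum_div]
  refine Finset.sum_congr rfl fun i _ ↦ ?_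
  have : 0 < 1 + p i * z := by have := mul_nonneg (hp i) hz; positivity
  have : ν * (z * invSum p z) * p i + ν * invSum p z = ν * invSum p z * (1 + p i * z) := by ring
  rw [this]
  field_simp

end ScalarResolvent

section Comparison

lemma le_of_scaling {ι : Type*} [Finite ι] {u v : ι → ℝ} (hv : 0 ≤ v)
    (h0 : ∀ i, v i = 0 → u i = 0)
    (step : ∀ α : ℝ, 1 < α → (∀ i, u i ≤ α * v i) → ∀ i, 0 < v i → u i < α * v i) : u ≤ v := by
  intro i
  by_contra! hi
  have : Nonempty ι := ⟨i⟩
  obtain ⟨m, hm⟩ := Finite.exists_max fun j ↦ u j / v j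
  have hpos : ∀ {j}, v j ≠ 0 → 0 < v j := fun {j} h ↦ (hv j).lt_of_ne' h
  have hvi : v i ≠ 0 := fun h ↦ by rw [h, h0 i h] at hi; exact hi.false
  have hα : 1 < u m / v m := ((one_lt_div (hpos hvi)).mpr hi).trans_le (hm i)
  have hvm : v m ≠ 0 := fun h ↦ by norm_num [h] at hα
  refine (step _ hα (fun j ↦ ?_) m (hpos hvm)).ne (div_mul_cancel₀ _ hvm).symm
  by_cases hj : v j = 0
  · simp [hj, h0 j hj]
  · exact (div_le_iff₀ (hpos hj)).mp (hm j)

lemma div_one_add_mul_le_div_one_add_mul {x y x' y' : ℝ} (hx : 0 ≤ x) (hy : 0 ≤ y)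
    (hy' : 0 ≤ y') (hx' : 0 ≤ x') (hxx' : x ≤ x') (hyy' : y' ≤ y) :
    x / (1 + y * x) ≤ x' / (1 + y' * x') := by
  rw [div_le_div_iff₀ (by positivity) (by positivity)]
  nlinarith [mul_le_mul_of_nonneg_right hyy' (mul_nonneg hx hx')]

lemma div_one_add_mul_le_mul {x y x' y' α : ℝ} (hx : 0 ≤ x) (hy : 0 ≤ y) (hx' : 0 ≤ x')
    (hy' : 0 ≤ y') (hxx' : x ≤ α * x') (hyy' : y' ≤ α * y) :
    x / (1 + y * x) ≤ α * (x' / (1 + y' * x')) := by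
  rw [← mul_div_assoc, div_le_div_iff₀ (by positivity) (by positivity)]
  nlinarith [mul_le_mul_of_nonneg_right hyy' (mul_nonneg hx hx')]

lemma div_one_add_mul_lt_mul {x y x' y' α : ℝ} (hx : 0 ≤ x) (hy : 0 ≤ y) (hx' : 0 ≤ x')
    (hy' : 0 ≤ y') (hxx' : x < α * x') (hyy' : y' ≤ α * y) :
    x / (1 + y * x) < α * (x' / (1 + y' * x')) := by
  rw [← mul_div_assoc, div_lt_div_iff₀ (by positivity) (by positivity)]
  nlinarith [mul_le_mul_of_nonneg_right hyy' (mul_nonneg hx hx')]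

lemma exists_isFixedPt_of_monotoneOn_Icc {β γ : Type*} [ConditionallyCompleteLattice β]
    [ConditionallyCompleteLattice γ] {a b : β × γ} (hab : a ≤ b) {T : β × γ → β × γ}
    (hmaps : Set.MapsTo T (Set.Icc a b) (Set.Icc a b)) (hmono : MonotoneOn T (Set.Icc a b)) :
    ∃ x ∈ Set.Icc a b, T x = x := by
  have : Fact (a.1 ≤ b.1) := ⟨hab.1⟩
  have : Fact (a.2 ≤ b.2) := ⟨hab.2⟩
  have hmem : ∀ x : Set.Icc a.1 b.1 × Set.Icc a.2 b.2, ((x.1 : β), (x.2 : γ)) ∈ Set.Icc a b :=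
    fun x ↦ ⟨⟨x.1.2.1, x.2.2.1⟩, ⟨x.1.2.2, x.2.2.2⟩⟩
  let f : Set.Icc a.1 b.1 × Set.Icc a.2 b.2 →o Set.Icc a.1 b.1 × Set.Icc a.2 b.2 :=
    { toFun := fun x ↦
        (⟨(T (x.1, x.2)).1, (hmaps (hmem x)).1.1, (hmaps (hmem x)).2.1⟩,
          ⟨(T (x.1, x.2)).2, (hmaps (hmem x)).1.2, (hmaps (hmem x)).2.2⟩)
      monotone' := fun x y hxy ↦
        have h := hmono (hmem x) (hmem y) ⟨hxy.1, hxy.2⟩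
        ⟨h.1, h.2⟩ }
  have h := f.map_lfp
  refine ⟨(f.lfp.1, f.lfp.2), hmem _, Prod.ext ?_ ?_⟩
  · exact congrArg (fun x ↦ (x.1 : β)) h
  · exact congrArg (fun x ↦ (x.2 : γ)) h

end Comparison

section FundamentalSystem

variable {κ : Type*} [Fintype κ] {ι μ : κ → Type*} [∀ k, Fintype (ι k)] [∀ k, Fintype (μ k)]

/-- The fundamental equations, with the pair `(gb k, g k)` parametrized by a real `z ≥ 0` and with
an abstract map `F` in place of the resolvent traces. -/
def IsFundamentalSolution (ν : ℝ) (q : (k : κ) → μ k → ℝ)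
    (F : (k : κ) → ι k → ((k : κ) → ι k → ℝ) → ℝ) (gb g : κ → ℝ) (δ : (k : κ) → ι k → ℝ) : Prop :=
  0 ≤ δ ∧
  (∀ k, ∃ z, 0 ≤ z ∧ gb k = weightedMean (q k) z ∧ g k = ν * (z * invSum (q k) z)) ∧
  (∀ k, g k = ν * ∑ j, δ k j / (1 + gb k * δ k j)) ∧
  ∀ k j, δ k j = F k j fun l m ↦ gb l / (1 + gb l * δ l m)

variable {ν : ℝ} {q : (k : κ) → μ k → ℝ} {F : (k : κ) → ι k → ((k : κ) → ι k → ℝ) → ℝ}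

lemma IsFundamentalSolution.scaling [∀ k, Nonempty (μ k)] (hν : 0 < ν) (hq : 0 ≤ q)
    (hF0 : ∀ k j a b, 0 ≤ a → 0 ≤ b → F k j a = 0 → F k j b = 0)
    (hF : ∀ k j a b (α : ℝ), 0 ≤ a → 0 ≤ b → 1 < α → a ≤ α • b → 0 < F k j a →
      F k j b < α * F k j a)
    {gb g gb' g' : κ → ℝ} {δ δ' : (k : κ) → ι k → ℝ}
    (h : IsFundamentalSolution ν q F gb g δ) (h' : IsFundamentalSolution ν q F gb' g' δ') :
    gb ≤ gb' ∧ δ' ≤ δ := by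
  obtain ⟨hδ, hz, hg, hδF⟩ := h
  obtain ⟨hδ', hz', hg', hδF'⟩ := h'
  choose z hz0 hgbz hgz using hz
  choose z' hz0' hgbz' hgz' using hz'
  have hgb : 0 ≤ gb := fun k ↦ by rw [hgbz]; exact weightedMean_nonneg (hq k) (hz0 k)
  have hgb' : 0 ≤ gb' := fun k ↦ by rw [hgbz']; exact weightedMean_nonneg (hq k) (hz0' k)
  have hden : ∀ k j, 0 < 1 + gb k * δ k j := fun k j ↦ by
    have := mul_nonneg (hgb k) (hδ k j); positivity
  have hden' : ∀ k j, 0 < 1 + gb' k * δ' k j := fun k j ↦ by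
    have := mul_nonneg (hgb' k) (hδ' k j); positivity
  have ha : (0 : (k : κ) → ι k → ℝ) ≤ fun l m ↦ gb l / (1 + gb l * δ l m) :=
    fun k j ↦ div_nonneg (hgb k) (hden k j).le
  have ha' : (0 : (k : κ) → ι k → ℝ) ≤ fun l m ↦ gb' l / (1 + gb' l * δ' l m) :=
    fun k j ↦ div_nonneg (hgb' k) (hden' k j).le
  have hδ0 : ∀ k j, δ k j = 0 → δ' k j = 0 := fun k j h0 ↦ by
    rw [hδF']; rw [hδF] at h0; exact hF0 k j _ _ ha ha' h0
  have hgb0 : ∀ k, gb' k = 0 → gb k = 0 := fun k h0 ↦ by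
    rw [hgbz', weightedMean_eq_zero_iff (hq k) (hz0' k)] at h0
    rw [hgbz, weightedMean_eq_zero_iff (hq k) (hz0 k), h0]
  have hterm : ∀ k j, 0 ≤ δ k j / (1 + gb k * δ k j) :=
    fun k j ↦ div_nonneg (hδ k j) (hden k j).le
  have key : ∀ α : ℝ, 1 < α → gb ≤ α • gb' → δ' ≤ α • δ →
      (∀ k, 0 < gb' k → gb k < α * gb' k) ∧ ∀ k j, 0 < δ k j → δ' k j < α * δ k j := by
    intro α hα h1 h2
    have hδlt : ∀ k j, 0 < δ k j → δ' k j < α * δ k j := fun k j hpos ↦ by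
      rw [hδF']; rw [hδF] at hpos ⊢
      refine hF k j _ _ α ha ha' hα (fun l m ↦ ?_) hpos
      have := div_one_add_mul_le_mul (hgb l) (hδ l m) (hgb' l) (hδ' l m) (h1 l) (h2 l m)
      simpa only [Pi.smul_apply, smul_eq_mul, mul_comm] using this
    refine ⟨fun k hpos ↦ ?_, hδlt⟩
    have hq0 : q k ≠ 0 := fun h0 ↦ by
      rw [hgbz', (weightedMean_eq_zero_iff (hq k) (hz0' k)).mpr h0] at hpos
      exact hpos.false
    have hS : z k * invSum (q k) (z k) = ∑ j, δ k j / (1 + gb k * δ k j) :=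
      mul_left_cancel₀ hν.ne' ((hgz k).symm.trans (hg k))
    have hS' : z' k * invSum (q k) (z' k) = ∑ j, δ' k j / (1 + gb' k * δ' k j) :=
      mul_left_cancel₀ hν.ne' ((hgz' k).symm.trans (hg' k))
    rw [hgbz, hgbz']
    refine weightedMean_lt_mul (hq k) hq0 (hz0 k) (hz0' k) hα ?_ ?_
    · rw [hS, hS', Finset.sum_eq_zero_iff_of_nonneg fun j _ ↦ hterm k j]
      intro h0
      refine Finset.sum_eq_zero fun j hj ↦ ?_
      have := (div_eq_zero_iff.mp (h0 j hj)).resolve_right (hden k j).ne'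
      rw [hδ0 k j this, zero_div]
    · rw [hS, hS']
      intro h0
      obtain ⟨j, hj, hjpos⟩ := (Finset.sum_pos_iff_of_nonneg fun j _ ↦ hterm k j).mp h0
      rw [Finset.mul_sum]
      have hjδ : 0 < δ k j := (hδ k j).lt_of_ne' fun h0 ↦ by simp [h0] at hjpos
      exact Finset.sum_lt_sum (fun i _ ↦ div_one_add_mul_le_mul (hδ' k i) (hgb' k) (hδ k i)
        (hgb k) (h2 k i) (h1 k)) ⟨j, hj, div_one_add_mul_lt_mul (hδ' k j) (hgb' k) (hδ k j)
        (hgb k) (hδlt k j hjδ) (h1 k)⟩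
  have hle := le_of_scaling (ι := κ ⊕ Σ k, ι k) (u := Sum.elim gb fun s ↦ δ' s.1 s.2)
    (v := Sum.elim gb' fun s ↦ δ s.1 s.2)
    (by rintro (k | s); exacts [hgb' k, hδ s.1 s.2])
    (by rintro (k | s); exacts [hgb0 k, hδ0 s.1 s.2])
    (fun α hα h1 ↦ by
      obtain ⟨h2, h3⟩ := key α hα (fun k ↦ h1 (.inl k)) (fun k j ↦ h1 (.inr ⟨k, j⟩))
      rintro (k | s)
      exacts [h2 k, h3 s.1 s.2])
  exact ⟨fun k ↦ hle (.inl k), fun k j ↦ hle (.inr ⟨k, j⟩)⟩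

lemma IsFundamentalSolution.unique [∀ k, Nonempty (μ k)] (hν : 0 < ν) (hq : 0 ≤ q)
    (hF0 : ∀ k j a b, 0 ≤ a → 0 ≤ b → F k j a = 0 → F k j b = 0)
    (hF : ∀ k j a b (α : ℝ), 0 ≤ a → 0 ≤ b → 1 < α → a ≤ α • b → 0 < F k j a →
      F k j b < α * F k j a)
    {gb g gb' g' : κ → ℝ} {δ δ' : (k : κ) → ι k → ℝ}
    (h : IsFundamentalSolution ν q F gb g δ) (h' : IsFundamentalSolution ν q F gb' g' δ') :
    gb = gb' ∧ g = g' ∧ δ = δ' := by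
  have h1 := h.scaling hν hq hF0 hF h'
  have h2 := h'.scaling hν hq hF0 hF h
  have e1 := le_antisymm h1.1 h2.1
  have e2 := le_antisymm h2.2 h1.2
  exact ⟨e1, funext fun k ↦ by rw [h.2.2.1 k, h'.2.2.1 k, e1, e2], e2⟩

lemma exists_isFundamentalSolution [∀ k, Nonempty (μ k)]
    (hcard : ∀ k, Fintype.card (ι k) = Fintype.card (μ k)) (hq : 0 ≤ q)
    (hFnonneg : ∀ k j a, 0 ≤ a → 0 ≤ F k j a)
    (hFanti : ∀ k j a b, 0 ≤ a → a ≤ b → F k j b ≤ F k j a) :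
    ∃ gb g δ, IsFundamentalSolution ν q F gb g δ := by
  obtain ⟨D, hD0, hD⟩ : ∃ D : ℝ, 0 ≤ D ∧ ∀ k j, F k j 0 ≤ D := by
    have hnn : ∀ k j, 0 ≤ F k j 0 := fun k j ↦ hFnonneg k j 0 le_rfl
    refine ⟨∑ k, ∑ j, F k j 0, Finset.sum_nonneg fun k _ ↦ Finset.sum_nonneg fun j _ ↦ hnn k j,
      fun k j ↦ ?_⟩
    exact (Finset.single_le_sum (f := fun j ↦ F k j 0) (fun j _ ↦ hnn k j)
      (Finset.mem_univ j)).trans (Finset.single_le_sum (f := fun k ↦ ∑ j, F k j 0)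
        (fun k _ ↦ Finset.sum_nonneg fun j _ ↦ hnn k j) (Finset.mem_univ k))
  let A : (κ → ℝ) × ((k : κ) → ι k → ℝ) → (k : κ) → ι k → ℝ := fun x l m ↦
    weightedMean (q l) (x.1 l) / (1 + weightedMean (q l) (x.1 l) * x.2 l m)
  let T : (κ → ℝ) × ((k : κ) → ι k → ℝ) → (κ → ℝ) × ((k : κ) → ι k → ℝ) := fun x ↦
    (fun k ↦ (∑ j, x.2 k j / (1 + weightedMean (q k) (x.1 k) * x.2 k j)) / invSum (q k) (x.1 k),
      fun k j ↦ F k j (A x))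
  let b : (κ → ℝ) × ((k : κ) → ι k → ℝ) := (fun _ ↦ D, fun _ _ ↦ D)
  have hb : 0 ≤ b := ⟨fun _ ↦ hD0, fun _ _ ↦ hD0⟩
  have hmean : ∀ {x : (κ → ℝ) × ((k : κ) → ι k → ℝ)}, 0 ≤ x → ∀ k,
      0 ≤ weightedMean (q k) (x.1 k) := fun hx k ↦ weightedMean_nonneg (hq k) (hx.1 k)
  have hden : ∀ {x : (κ → ℝ) × ((k : κ) → ι k → ℝ)}, 0 ≤ x → ∀ k j,
      0 < 1 + weightedMean (q k) (x.1 k) * x.2 k j := fun {x} hx k j ↦ by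
    have : 0 ≤ weightedMean (q k) (x.1 k) * x.2 k j := mul_nonneg (hmean hx k) (hx.2 k j)
    positivity
  have hA : ∀ {x}, 0 ≤ x → 0 ≤ A x := fun hx k j ↦ div_nonneg (hmean hx k) (hden hx k j).le
  have hsum : ∀ {x : (κ → ℝ) × ((k : κ) → ι k → ℝ)}, 0 ≤ x → ∀ k,
      0 ≤ ∑ j, x.2 k j / (1 + weightedMean (q k) (x.1 k) * x.2 k j) := fun {x} hx k ↦
    Finset.sum_nonneg fun j _ ↦ div_nonneg (hx.2 k j) (hden hx k j).le
  have hT0 : ∀ {x}, 0 ≤ x → 0 ≤ T x := fun hx ↦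
    ⟨fun k ↦ div_nonneg (hsum hx k) (invSum_pos (hq k) (hx.1 k)).le,
      fun k j ↦ hFnonneg k j _ (hA hx)⟩
  have hmono : ∀ {x y}, 0 ≤ x → x ≤ y → T x ≤ T y := by
    intro x y hx hxy
    have hy := hx.trans hxy
    have hm : ∀ k, weightedMean (q k) (y.1 k) ≤ weightedMean (q k) (x.1 k) :=
      fun k ↦ weightedMean_antitone (hq k) (hx.1 k) (hxy.1 k)
    refine ⟨fun k ↦ ?_, fun k j ↦ hFanti k j _ _ (hA hy) fun l m ↦ ?_⟩
    · exact div_le_div₀ (hsum hy k) (Finset.sum_le_sum fun j _ ↦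
        div_one_add_mul_le_div_one_add_mul (hx.2 k j) (hmean hx k) (hmean hy k) (hy.2 k j)
          (hxy.2 k j) (hm k)) (invSum_pos (hq k) (hy.1 k))
        (invSum_antitone (hq k) (hx.1 k) (hxy.1 k))
    · have := div_one_add_mul_le_div_one_add_mul (hmean hy l) (hy.2 l m) (hx.2 l m) (hmean hx l)
        (hm l) (hxy.2 l m)
      simpa only [A, mul_comm] using this
  have hTb : T b ≤ b := by
    refine ⟨fun k ↦ ?_, fun k j ↦ (hFanti k j 0 _ le_rfl (hA hb)).trans (hD k j)⟩
    have hI := invSum_pos (hq k) hD0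
    have hm := weightedMean_nonneg (hq k) hD0
    have h := invSum_add_mul_weightedInvSum (hq k) hD0
    have hw : weightedInvSum (q k) D = weightedMean (q k) D * invSum (q k) D :=
      (div_mul_cancel₀ _ hI.ne').symm
    refine le_of_eq ?_
    change (∑ _j : ι k, D / (1 + weightedMean (q k) D * D)) / invSum (q k) D = D
    have h1 : 0 < 1 + weightedMean (q k) D * D := by positivity
    rw [Finset.sum_const, Finset.card_univ, hcard, nsmul_eq_mul, ← h, hw]
    field_simp
  obtain ⟨x, hx, hTx⟩ := exists_isFixedPt_of_monotoneOn_Icc hb (T := T)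
    (fun x hx ↦ ⟨hT0 hx.1, (hmono hx.1 hx.2).trans hTb⟩)
    (fun x hx y _ hxy ↦ hmono hx.1 hxy)
  refine ⟨fun k ↦ weightedMean (q k) (x.1 k), fun k ↦ ν * (x.1 k * invSum (q k) (x.1 k)), x.2,
    hx.1.2, fun k ↦ ⟨x.1 k, hx.1.1 k, rfl, rfl⟩, fun k ↦ ?_, fun k j ↦ ?_⟩
  · have h : (T x).1 k = x.1 k := by rw [hTx]
    exact congrArg (ν * ·) ((div_eq_iff (invSum_pos (hq k) (hx.1.1 k)).ne').mp h).symm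
  · have h : (T x).2 k j = x.2 k j := by rw [hTx]
    exact h.symm

end FundamentalSystem

lemma trace_mul_inv_smul_add_smul_one {n : Type*} [Fintype n] [DecidableEq n] {P : Matrix n n ℝ}
    (hP : P.IsDiag) (hP0 : ∀ i, 0 ≤ P i i) {g t : ℝ} (hg : 0 ≤ g) (ht : 0 < t) :
    (P * (g • P + t • (1 : Matrix n n ℝ))⁻¹).trace = ∑ i, P i i / (g * P i i + t) := by
  have hinv : (g • P + t • (1 : Matrix n n ℝ))⁻¹ = diagonal fun i ↦ (g * P i i + t)⁻¹ := by
    refine Matrix.inv_eq_left_inv ?_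
    have h : g • P + t • (1 : Matrix n n ℝ) = diagonal fun i ↦ g * P i i + t := by
      nth_rewrite 1 [← hP.diagonal_diag]
      ext i j
      by_cases hij : i = j
      · subst hij; simp
      · simp [hij]
    rw [h, diagonal_mul_diagonal, ← diagonal_one]
    congr 1
    ext i
    exact inv_mul_cancel₀ (by have := mul_nonneg hg (hP0 i); positivity)
  rw [hinv, Matrix.trace]
  simp [div_eq_mul_inv]

/-- **Fundamental equations (Theorem 3, existence and uniqueness).**
The system of implicit equations
`ḡ_k = (1/N)·tr(P_k (g_k P_k + (c̄_k − g_k ḡ_k) I)⁻¹)`,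
`g_k = (1/N)·Σ_j δ_{kj}/(1 + ḡ_k δ_{kj})`,
`δ_{kj} = (1/N)·tr(R_{kj} ((1/N)·Σ_{l,m} ḡ_l R_{lm}/(1+ḡ_l δ_{lm}) + ρ I_N)⁻¹)`
has a unique solution with `δ_{kj} ≥ 0`, `g_k ≥ 0`, `0 ≤ ḡ_k` and `g_k ḡ_k < c_k c̄_k`. -/
theorem fundamental_equations_unique_solution
    (N K : ℕ) (hN : 0 < N) (hK : 0 < K)
    (Nk nk : Fin K → ℕ) (hNk : ∀ k, 0 < Nk k) (hnk : ∀ k, 0 < nk k)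
    (hnkNk : ∀ k, nk k ≤ Nk k)
    (c cbar : Fin K → ℝ)
    (hc : ∀ k, c k = (nk k : ℝ) / (Nk k : ℝ))
    (hcbar : ∀ k, cbar k = (Nk k : ℝ) / (N : ℝ))
    (P : (k : Fin K) → Matrix (Fin (nk k)) (Fin (nk k)) ℝ)
    (hPdiag : ∀ k, (P k).IsDiag) (hPpos : ∀ k i, 0 ≤ P k i i)
    (R : (k : Fin K) → Fin (Nk k) → Matrix (Fin N) (Fin N) ℂ)
    (hRherm : ∀ k j, (R k j).IsHermitian) (hRpsd : ∀ k j, (R k j).PosSemidef)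
    (ρ : ℝ) (hρ : 0 < ρ) :
    ∃! s : (Fin K → ℝ) × (Fin K → ℝ) × ((k : Fin K) → Fin (Nk k) → ℝ),
      (∀ k j, 0 ≤ s.2.2 k j) ∧
      (∀ k, 0 ≤ s.2.1 k) ∧
      (∀ k, 0 ≤ s.1 k ∧ s.2.1 k * s.1 k < c k * cbar k) ∧
      (∀ k, s.1 k = (1 / (N : ℝ)) *
        (P k * (s.2.1 k • P k +
          (cbar k - s.2.1 k * s.1 k) • (1 : Matrix (Fin (nk k)) (Fin (nk k)) ℝ))⁻¹).trace) ∧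
      (∀ k, s.2.1 k = (1 / (N : ℝ)) *
        ∑ j, s.2.2 k j / (1 + s.1 k * s.2.2 k j)) ∧
      (∀ k j, ((s.2.2 k j : ℂ)) = (1 / (N : ℂ)) *
        (R k j *
          ((1 / (N : ℂ)) • (∑ l, ∑ m, ((s.1 l / (1 + s.1 l * s.2.2 l m) : ℝ) : ℂ) • R l m)
            + (ρ : ℂ) • (1 : Matrix (Fin N) (Fin N) ℂ))⁻¹).trace) := by
  have hN' : (0 : ℝ) < N := by exact_mod_cast hN
  set ν : ℝ := 1 / (N : ℝ) with hν_def
  have hν : 0 < ν := by positivity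
  let μ : Fin K → Type := fun k ↦ Fin (nk k) ⊕ Fin (Nk k - nk k)
  have : ∀ k, Nonempty (μ k) := fun k ↦ ⟨.inl ⟨0, hnk k⟩⟩
  let q : (k : Fin K) → μ k → ℝ := fun k ↦ Sum.elim (fun i ↦ P k i i) 0
  have hq : 0 ≤ q := by
    rintro k (i | i)
    exacts [hPpos k i, le_rfl]
  have hcard : ∀ k, Fintype.card (μ k) = Nk k := fun k ↦ by
    simpa [μ] using Nat.add_sub_cancel' (hnkNk k)
  have hcb : ∀ k, cbar k = ν * Fintype.card (μ k) := fun k ↦ by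
    rw [hcbar, hcard, hν_def]; ring
  have hccb : ∀ k, c k * cbar k = ν * nk k := fun k ↦ by
    have : (Nk k : ℝ) ≠ 0 := by exact_mod_cast (hNk k).ne'
    rw [hc, hcbar, hν_def]; field_simp
  let F : (k : Fin K) → Fin (Nk k) → ((k : Fin K) → Fin (Nk k) → ℝ) → ℝ :=
    fun k j ↦ resolventTrace ν ρ R (R k j)
  have hqsum : ∀ k (g t : ℝ), ∑ i, q k i / (g * q k i + t) =
      ∑ i, P k i i / (g * P k i i + t) := fun k g t ↦ by
    simp [q, μ, Fintype.sum_sum_type]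
  have hequiv : ∀ s : (Fin K → ℝ) × (Fin K → ℝ) × ((k : Fin K) → Fin (Nk k) → ℝ),
      ((∀ k j, 0 ≤ s.2.2 k j) ∧
      (∀ k, 0 ≤ s.2.1 k) ∧
      (∀ k, 0 ≤ s.1 k ∧ s.2.1 k * s.1 k < c k * cbar k) ∧
      (∀ k, s.1 k = ν *
        (P k * (s.2.1 k • P k +
          (cbar k - s.2.1 k * s.1 k) • (1 : Matrix (Fin (nk k)) (Fin (nk k)) ℝ))⁻¹).trace) ∧
      (∀ k, s.2.1 k = ν * ∑ j, s.2.2 k j / (1 + s.1 k * s.2.2 k j)) ∧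
      (∀ k j, ((s.2.2 k j : ℂ)) = (1 / (N : ℂ)) *
        (R k j *
          ((1 / (N : ℂ)) • (∑ l, ∑ m, ((s.1 l / (1 + s.1 l * s.2.2 l m) : ℝ) : ℂ) • R l m)
            + (ρ : ℂ) • (1 : Matrix (Fin N) (Fin N) ℂ))⁻¹).trace)) ↔
      IsFundamentalSolution ν q F s.1 s.2.1 s.2.2 := by
    rintro ⟨gb, g, δ⟩
    have hδiff : 0 ≤ δ → 0 ≤ gb → ((∀ k j, (δ k j : ℂ) = (1 / (N : ℂ)) *
        (R k j *
          ((1 / (N : ℂ)) • (∑ l, ∑ m, ((gb l / (1 + gb l * δ l m) : ℝ) : ℂ) • R l m)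
            + (ρ : ℂ) • (1 : Matrix (Fin N) (Fin N) ℂ))⁻¹).trace) ↔
        ∀ k j, δ k j = F k j fun l m ↦ gb l / (1 + gb l * δ l m)) := fun hδ hgb ↦ by
      refine forall_congr' fun k ↦ forall_congr' fun j ↦ ?_
      have h := ofReal_resolventTrace hν.le hρ hRpsd (hRpsd k j)
        (a := fun l m ↦ gb l / (1 + gb l * δ l m)) fun l m ↦
          div_nonneg (hgb l) (by have := mul_nonneg (hgb l) (hδ l m); positivity)
      have hνC : (1 / (N : ℂ)) = (ν : ℂ) := by simp [hν_def]
      rw [hνC, ← Complex.ofReal_inj]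
      exact Eq.congr_right h.symm
    constructor
    · rintro ⟨hδ, hg, hgb, hgbeq, hgeq, hδeq⟩
      refine ⟨hδ, fun k ↦ ?_, hgeq, (hδiff hδ fun k ↦ (hgb k).1).mp hδeq⟩
      have hlt : g k * gb k < ν * Fintype.card (μ k) := by
        refine (hgb k).2.trans_le ?_
        rw [hccb, hcard]
        exact mul_le_mul_of_nonneg_left (by exact_mod_cast hnkNk k) hν.le
      refine exists_eq_weightedMean (hq k) hν (hg k) hlt ?_
      rw [hqsum, ← trace_mul_inv_smul_add_smul_one (hPdiag k) (hPpos k) (hg k) (sub_pos.mpr hlt),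
        ← hcb]
      exact hgbeq k
    · rintro ⟨hδ, hz, hgeq, hδeq⟩
      dsimp only at hz
      have hgb : 0 ≤ gb := fun k ↦ by
        obtain ⟨z, hz0, h, -⟩ := hz k
        rw [h]
        exact weightedMean_nonneg (hq k) hz0
      have hg : 0 ≤ g := fun k ↦ by
        obtain ⟨z, hz0, -, h⟩ := hz k
        rw [h]
        exact mul_nonneg hν.le (mul_nonneg hz0 (invSum_pos (hq k) hz0).le)
      have hlt : ∀ k, 0 < cbar k - g k * gb k := fun k ↦ by
        obtain ⟨z, hz0, h1, h2⟩ := hz k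
        rw [hcb, h1, h2, sub_pos]
        exact (weightedMean_eq_sum (hq k) hν hz0).1
      have hgbsum : ∀ k, gb k =
          ν * ∑ i, P k i i / (g k * P k i i + (cbar k - g k * gb k)) := fun k ↦ by
        obtain ⟨z, hz0, h1, h2⟩ := hz k
        rw [← hqsum, hcb, h2, h1]
        exact (weightedMean_eq_sum (hq k) hν hz0).2
      refine ⟨hδ, hg, fun k ↦ ⟨hgb k, ?_⟩, fun k ↦ ?_, hgeq, (hδiff hδ hgb).mpr hδeq⟩
      · change g k * gb k < _
        have hne : (Finset.univ : Finset (Fin (nk k))).Nonempty := ⟨⟨0, hnk k⟩, Finset.mem_univ _⟩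
        have hsum : g k * ∑ i, P k i i / (g k * P k i i + (cbar k - g k * gb k)) <
            ∑ _i : Fin (nk k), (1 : ℝ) := by
          rw [Finset.mul_sum]
          refine Finset.sum_lt_sum_of_nonempty hne fun i _ ↦ ?_
          have h1 := mul_nonneg (hg k) (hPpos k i)
          rw [← mul_div_assoc, div_lt_one (by linarith [hlt k])]
          linarith [hlt k]
        rw [Finset.sum_const, Finset.card_univ, Fintype.card_fin, nsmul_eq_mul, mul_one] at hsum
        rw [hccb]
        calc g k * gb k = ν * (g k * ∑ i, P k i i / (g k * P k i i + (cbar k - g k * gb k))) := by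
              nth_rewrite 1 [hgbsum k]; ring
          _ < ν * nk k := mul_lt_mul_of_pos_left hsum hν
      · change gb k = ν * (P k * (g k • P k + (cbar k - g k * gb k) • 1)⁻¹).trace
        rw [trace_mul_inv_smul_add_smul_one (hPdiag k) (hPpos k) (hg k) (hlt k)]
        exact hgbsum k
  refine (existsUnique_congr fun s ↦ hequiv s).mpr ?_
  obtain ⟨gb, g, δ, h⟩ := exists_isFundamentalSolution (ν := ν) (q := q) (F := F)
    (fun k ↦ by rw [hcard, Fintype.card_fin]) hq
    (fun k j a ha ↦ resolventTrace_nonneg hν.le hρ hRpsd (hRpsd k j) ha)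
    (fun k j a b ha hab ↦ resolventTrace_antitone hν.le hρ hRpsd (hRpsd k j) ha hab)
  refine ⟨(gb, g, δ), h, ?_⟩
  rintro ⟨gb', g', δ'⟩ h'
  obtain ⟨h1, h2, h3⟩ := h'.unique hν hq
    (fun k j a b ha hb h0 ↦ (resolventTrace_eq_zero_iff hν hρ hRpsd (hRpsd k j) hb).mpr
      ((resolventTrace_eq_zero_iff hν hρ hRpsd (hRpsd k j) ha).mp h0))
    (fun k j a b α ha hb hα hab hpos ↦ resolventTrace_lt_mul hν hρ hRpsd (hRpsd k j)
      (fun h0 ↦ hpos.ne' ((resolventTrace_eq_zero_iff hν hρ hRpsd (hRpsd k j) ha).mpr h0))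
      ha hb hα hab) h
  exact Prod.ext h1 (Prod.ext h2 h3)
end

section
/- For any fixed nonnegative reals ḡ_1,…,ḡ_K, the δ-system δ_{kj} = (1/N)·tr( R_{kj} ( (1/N)·Σ_{l=1}^{K} Σ_{m=1}^{N_l} ḡ_l R_{lm}/(1 + ḡ_l δ_{lm}) + ρ I_N )^{-1} ), for k ∈ {1,…,K} and j ∈ {1,…,N_k}, has a unique solution (δ_{kj})_{k,j} with δ_{kj} ≥ 0 for all k, j. -/
open Matrix
open scoped ComplexOrder

/-- The δ-system: `δ_{kj} = (1/N)·tr(R_{kj} ((1/N)·Σ_{l,m} ḡ_l R_{lm}/(1+ḡ_l δ_{lm}) + ρ I_N)⁻¹)`. -/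
def DeltaSystem (N K : ℕ) (Nk : Fin K → ℕ)
    (R : (k : Fin K) → Fin (Nk k) → Matrix (Fin N) (Fin N) ℂ) (ρ : ℝ)
    (gbar : Fin K → ℝ) (δ : (k : Fin K) → Fin (Nk k) → ℝ) : Prop :=
  ∀ k j, ((δ k j : ℂ)) = (1 / (N : ℂ)) *
    (R k j *
      ((1 / (N : ℂ)) • (∑ l, ∑ m, ((gbar l / (1 + gbar l * δ l m) : ℝ) : ℂ) • R l m)
        + (ρ : ℂ) • (1 : Matrix (Fin N) (Fin N) ℂ))⁻¹).trace

/-- A monotone, bounded, strictly subhomogeneous self-map of the nonnegative orthant has exactly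
one fixed point there; coordinates that vanish identically are exempt from strictness. -/
theorem existsUnique_fixedPoint_of_subhomogeneous {ι : Type*} [Finite ι]
    (F : (ι → ℝ) → ι → ℝ) (B : ι → ℝ)
    (nonneg : ∀ x, 0 ≤ x → 0 ≤ F x) (bound : ∀ x, 0 ≤ x → F x ≤ B)
    (mono : ∀ x y, 0 ≤ x → x ≤ y → F x ≤ F y)
    (sub : ∀ i, (∀ x, 0 ≤ x → F x i = 0) ∨
      ∀ x, 0 ≤ x → ∀ t : ℝ, 1 < t → F (t • x) i < t * F x i) :
    ∃! x : ι → ℝ, 0 ≤ x ∧ F x = x := by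
  have hB : 0 ≤ B := (nonneg 0 le_rfl).trans (bound 0 le_rfl)
  have le_of_fixed : ∀ x y : ι → ℝ, 0 ≤ x → F x = x → 0 ≤ y → F y = y → y ≤ x := by
    intro x y hx hFx hy hFy
    have pos : ∀ i, 0 < y i → 0 < x i ∧
        ∀ t : ℝ, 1 < t → F (t • x) i < t * F x i := by
      intro i hi
      rcases sub i with h | h
      · have := h y hy
        rw [hFy] at this
        exact absurd this hi.ne'
      · refine ⟨?_, h x hx⟩
        have h1 := h x hx 2 one_lt_two
        have h2 : 0 ≤ F ((2 : ℝ) • x) i := nonneg _ (smul_nonneg zero_le_two hx) i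
        rw [hFx] at h1
        linarith
    by_contra hle
    obtain ⟨i₀, hi₀⟩ : ∃ i, x i < y i := by simpa [Pi.le_def] using hle
    have : Nonempty ι := ⟨i₀⟩
    obtain ⟨i, hi⟩ := Finite.exists_max fun i => y i / x i
    set t := y i / x i with ht_def
    have hx₀ : 0 < x i₀ := (pos i₀ ((hx i₀).trans_lt hi₀)).1
    have ht : 1 < t := ((one_lt_div hx₀).2 hi₀).trans_le (hi i₀)
    have hyx : y ≤ t • x := by
      intro j
      rcases (hy j).eq_or_lt with h | h
      · rw [← h]
        exact smul_nonneg (zero_le_one.trans ht.le) hx j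
      · exact (div_le_iff₀ (pos j h).1).1 (hi j)
    have hyi : 0 < y i := by
      refine (hy i).lt_of_ne fun h => ?_
      rw [ht_def, ← h, Pi.zero_apply, zero_div] at ht
      linarith
    obtain ⟨hxi, hlt⟩ := pos i hyi
    have h1 := mono y (t • x) hy hyx i
    have h2 := hlt t ht
    rw [hFy] at h1
    rw [hFx, ht_def, div_mul_cancel₀ _ hxi.ne'] at h2
    exact absurd (h1.trans_lt h2) (lt_irrefl _)
  have : Fact ((0 : ι → ℝ) ≤ B) := ⟨hB⟩
  let G : Set.Icc (0 : ι → ℝ) B →o Set.Icc (0 : ι → ℝ) B :=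
    { toFun := fun x => ⟨F x, nonneg x x.2.1, bound x x.2.1⟩
      monotone' := fun x y h => mono x y x.2.1 h }
  have hG := G.map_lfp
  refine ⟨G.lfp, ⟨G.lfp.2.1, congrArg Subtype.val hG⟩, ?_⟩
  rintro y ⟨hy, hFy⟩
  exact le_antisymm (le_of_fixed _ _ G.lfp.2.1 (congrArg Subtype.val hG) hy hFy)
    (le_of_fixed _ _ hy hFy G.lfp.2.1 (congrArg Subtype.val hG))

namespace Matrix

variable {n ι : Type*} [Fintype ι]

theorem posSemidef_smul_sum {R : ι → Matrix n n ℂ} {a : ℝ}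
    (hR : ∀ i, (R i).PosSemidef) (ha : 0 ≤ a) {c : ι → ℝ} (hc : 0 ≤ c) :
    ((a : ℂ) • ∑ i, (c i : ℂ) • R i).PosSemidef :=
  (posSemidef_sum _ fun i _ => (hR i).smul (Complex.zero_le_real.2 (hc i))).smul
    (Complex.zero_le_real.2 ha)

variable [DecidableEq n]

/-- The positive combination `a • ∑ i, c i • R i + ρ • 1`. -/
noncomputable def regularizedSum (R : ι → Matrix n n ℂ) (a ρ : ℝ) (c : ι → ℝ) : Matrix n n ℂ :=
  (a : ℂ) • ∑ i, (c i : ℂ) • R i + (ρ : ℂ) • 1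

theorem regularizedSum_sub_smul (R : ι → Matrix n n ℂ) (a ρ t : ℝ) (c d : ι → ℝ) :
    regularizedSum R a ρ d - (t : ℂ) • regularizedSum R a ρ c =
      regularizedSum R a ((1 - t) * ρ) (d - t • c) := by
  simp only [regularizedSum, Pi.sub_apply, Pi.smul_apply, smul_eq_mul, Complex.ofReal_sub,
    Complex.ofReal_mul, Complex.ofReal_one, sub_smul, Finset.sum_sub_distrib, mul_smul,
    ← Finset.smul_sum, smul_add, smul_sub, one_smul]
  rw [smul_comm (t : ℂ) (a : ℂ)]
  abel

theorem regularizedSum_posDef {R : ι → Matrix n n ℂ} {a ρ : ℝ}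
    (hR : ∀ i, (R i).PosSemidef) (ha : 0 ≤ a) (hρ : 0 < ρ) {c : ι → ℝ} (hc : 0 ≤ c) :
    (regularizedSum R a ρ c).PosDef :=
  (PosDef.one.smul (Complex.zero_lt_real.2 hρ)).posSemidef_add (posSemidef_smul_sum hR ha hc)

variable [Fintype n]

theorem PosDef.inv_sub_inv_eq {A B : Matrix n n ℂ} (hA : A.PosDef) (hB : B.PosDef) :
    A⁻¹ - B⁻¹ = B⁻¹ * ((B - A) + (B - A) * A⁻¹ * (B - A)) * B⁻¹ := by
  have hA' : IsUnit A.det := (isUnit_iff_isUnit_det A).1 hA.isUnit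
  have hB' : IsUnit B.det := (isUnit_iff_isUnit_det B).1 hB.isUnit
  have h1 : (B - A) + (B - A) * A⁻¹ * (B - A) = (B - A) * A⁻¹ * B := by
    rw [mul_sub _ B A, nonsing_inv_mul_cancel_right _ _ hA']
    abel
  rw [h1, ← mul_assoc, mul_nonsing_inv_cancel_right _ _ hB', ← mul_assoc, mul_sub, sub_mul,
    nonsing_inv_mul _ hB', one_mul, mul_nonsing_inv_cancel_right _ _ hA']

theorem PosDef.inv_sub_inv_posSemidef {A B : Matrix n n ℂ} (hA : A.PosDef)
    (h : (B - A).PosSemidef) : (A⁻¹ - B⁻¹).PosSemidef := by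
  have hB : B.PosDef := by simpa using hA.add_posSemidef h
  rw [hA.inv_sub_inv_eq hB]
  have h2 := hA.inv.posSemidef.mul_mul_conjTranspose_same (B - A)
  rw [h.isHermitian.eq] at h2
  have h3 := (h.add h2).mul_mul_conjTranspose_same B⁻¹
  rwa [hB.inv.isHermitian.eq] at h3

theorem PosDef.inv_sub_inv_posDef {A B : Matrix n n ℂ} (hA : A.PosDef)
    (h : (B - A).PosDef) : (A⁻¹ - B⁻¹).PosDef := by
  have hB : B.PosDef := by simpa using hA.add h
  rw [hA.inv_sub_inv_eq hB]
  have h2 := hA.inv.posSemidef.mul_mul_conjTranspose_same (B - A)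
  rw [h.isHermitian.eq] at h2
  have h3 := (h.add_posSemidef h2).mul_mul_conjTranspose_same (B := B⁻¹)
    (vecMul_injective_of_isUnit hB.inv.isUnit)
  rwa [hB.inv.isHermitian.eq] at h3

open scoped MatrixOrder Matrix.Norms.L2Operator in
theorem PosSemidef.exists_eq_conjTranspose_mul_self {A : Matrix n n ℂ} (hA : A.PosSemidef) :
    ∃ C : Matrix n n ℂ, A = Cᴴ * C :=
  CStarAlgebra.nonneg_iff_eq_star_mul_self.mp hA.nonneg

theorem PosSemidef.trace_mul_nonneg {A B : Matrix n n ℂ} (hA : A.PosSemidef)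
    (hB : B.PosSemidef) : 0 ≤ (A * B).trace := by
  obtain ⟨C, rfl⟩ := hB.exists_eq_conjTranspose_mul_self
  rw [← mul_assoc, trace_mul_comm, ← mul_assoc]
  exact (hA.mul_mul_conjTranspose_same C).trace_nonneg

theorem PosSemidef.trace_mul_pos {A B : Matrix n n ℂ} (hA : A.PosSemidef) (hA0 : A ≠ 0)
    (hB : B.PosDef) : 0 < (A * B).trace := by
  refine (hA.trace_mul_nonneg hB.posSemidef).lt_of_ne fun h => hA0 ?_
  obtain ⟨C, rfl⟩ := hB.posSemidef.exists_eq_conjTranspose_mul_self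
  have hC : IsUnit C := isUnit_of_mul_isUnit_right hB.isUnit
  rw [← mul_assoc, trace_mul_comm, ← mul_assoc] at h
  have h0 := (hA.mul_mul_conjTranspose_same C).trace_eq_zero_iff.1 h.symm
  rw [← star_eq_conjTranspose, hC.star.mul_left_eq_zero, hC.mul_right_eq_zero] at h0
  exact h0

variable {R : ι → Matrix n n ℂ} {a ρ : ℝ}

theorem trace_mul_inv_regularizedSum_anti (hR : ∀ i, (R i).PosSemidef) (ha : 0 ≤ a) (hρ : 0 < ρ)
    {c d : ι → ℝ} (hc : 0 ≤ c) (hcd : c ≤ d) (i : ι) :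
    (R i * (regularizedSum R a ρ d)⁻¹).trace ≤ (R i * (regularizedSum R a ρ c)⁻¹).trace := by
  have h : (regularizedSum R a ρ d - regularizedSum R a ρ c).PosSemidef := by
    have := regularizedSum_sub_smul R a ρ 1 c d
    simp only [Complex.ofReal_one, one_smul, sub_self, zero_mul] at this
    rw [this]
    simpa [regularizedSum] using posSemidef_smul_sum hR ha (sub_nonneg.2 hcd)
  have h2 := (hR i).trace_mul_nonneg ((regularizedSum_posDef hR ha hρ hc).inv_sub_inv_posSemidef h)
  rwa [mul_sub, trace_sub, sub_nonneg] at h2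

theorem trace_mul_inv_regularizedSum_lt (hR : ∀ i, (R i).PosSemidef) (ha : 0 ≤ a) (hρ : 0 < ρ)
    {c d : ι → ℝ} (hc : 0 ≤ c) {t : ℝ} (ht : 1 < t) (hcd : c ≤ t • d) {i : ι} (hi : R i ≠ 0) :
    (R i * (regularizedSum R a ρ d)⁻¹).trace <
      t * (R i * (regularizedSum R a ρ c)⁻¹).trace := by
  have ht0 : 0 < t := zero_lt_one.trans ht
  have hA := regularizedSum_posDef hR ha hρ hc
  have h : (regularizedSum R a ρ d - ((t⁻¹ : ℝ) : ℂ) • regularizedSum R a ρ c).PosDef := by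
    rw [regularizedSum_sub_smul]
    refine regularizedSum_posDef hR ha (mul_pos (sub_pos.2 (inv_lt_one_of_one_lt₀ ht)) hρ) ?_
    rw [sub_nonneg]
    intro j
    exact (inv_mul_le_iff₀ ht0).2 (hcd j)
  have h2 := (hR i).trace_mul_pos hi
    ((hA.smul (Complex.zero_lt_real.2 (inv_pos.2 ht0))).inv_sub_inv_posDef h)
  have hinv : (((t⁻¹ : ℝ) : ℂ) • regularizedSum R a ρ c)⁻¹ =
      (t : ℂ) • (regularizedSum R a ρ c)⁻¹ := by
    refine inv_eq_left_inv ?_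
    have : (t : ℂ) ≠ 0 := Complex.ofReal_ne_zero.2 ht0.ne'
    rw [smul_mul_smul_comm, nonsing_inv_mul _ ((isUnit_iff_isUnit_det _).1 hA.isUnit),
      Complex.ofReal_inv, mul_inv_cancel₀ this, one_smul]
  rwa [hinv, mul_sub, trace_sub, sub_pos, mul_smul_comm, trace_smul, smul_eq_mul] at h2

/-- The resolvent trace equations for positive semidefinite `R i` have exactly one nonnegative
solution. -/
theorem existsUnique_resolvent_fixedPoint (hR : ∀ i, (R i).PosSemidef) (ha : 0 < a) (hρ : 0 < ρ)
    {g : ι → ℝ} (hg : 0 ≤ g) :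
    ∃! x : ι → ℝ, 0 ≤ x ∧ ∀ i, (x i : ℂ) =
      a * (R i * (regularizedSum R a ρ fun j => g j / (1 + g j * x j))⁻¹).trace := by
  set T : (ι → ℝ) → ι → ℂ := fun c i => a * (R i * (regularizedSum R a ρ c)⁻¹).trace with hT
  set w : (ι → ℝ) → ι → ℝ := fun x j => g j / (1 + g j * x j) with hw_def
  have hden : ∀ x : ι → ℝ, 0 ≤ x → ∀ j, 0 < 1 + g j * x j := fun x hx j =>
    add_pos_of_pos_of_nonneg one_pos (mul_nonneg (hg j) (hx j))
  have hw : ∀ x, 0 ≤ x → 0 ≤ w x := fun x hx j => div_nonneg (hg j) (hden x hx j).le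
  have haC : (0 : ℂ) < a := Complex.zero_lt_real.2 ha
  have hT0 : ∀ c, 0 ≤ c → ∀ i, 0 ≤ T c i := fun c hc i => mul_nonneg haC.le
    ((hR i).trace_mul_nonneg (regularizedSum_posDef hR ha.le hρ hc).inv.posSemidef)
  have hre : ∀ c, 0 ≤ c → ∀ i, ((T c i).re : ℂ) = T c i := fun c hc i =>
    (Complex.eq_re_of_ofReal_le (r := 0) (by simpa using hT0 c hc i)).symm
  have anti : ∀ c d, 0 ≤ c → c ≤ d → ∀ i, (T d i).re ≤ (T c i).re := fun c d hc hcd i =>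
    (Complex.le_def.1 (mul_le_mul_of_nonneg_left
      (trace_mul_inv_regularizedSum_anti hR ha.le hρ hc hcd i) haC.le)).1
  have main := existsUnique_fixedPoint_of_subhomogeneous (fun x i => (T (w x) i).re)
    (fun i => (T 0 i).re)
    (fun x hx i => (Complex.le_def.1 (hT0 _ (hw x hx) i)).1)
    (fun x hx => anti 0 _ le_rfl (hw x hx))
    (fun x y hx hxy => anti _ _ (hw y (hx.trans hxy)) fun j => by
      have := mul_le_mul_of_nonneg_left (hxy j) (hg j)
      exact div_le_div_of_nonneg_left (hg j) (hden x hx j) (by linarith))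
    (fun i => by
      by_cases hi : R i = 0
      · exact Or.inl fun x _ => by simp [hT, hi]
      refine Or.inr fun x hx t ht => ?_
      have ht0 : 0 < t := zero_lt_one.trans ht
      have hle : w x ≤ t • w (t • x) := by
        intro j
        have h1 := hden x hx j
        have h2 := hden (t • x) (smul_nonneg ht0.le hx) j
        simp only [hw_def, Pi.smul_apply, smul_eq_mul] at h2 ⊢
        rw [← mul_div_assoc, div_le_div_iff₀ h1 h2]
        have := hg j
        nlinarith [mul_nonneg this (sub_nonneg.2 ht.le)]
      have h := mul_lt_mul_of_pos_left
        (trace_mul_inv_regularizedSum_lt hR ha.le hρ (hw x hx) ht hle hi) haC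
      rw [mul_left_comm] at h
      exact (Complex.lt_def.1 h).1.trans_eq (Complex.re_ofReal_mul _ _))
  refine (existsUnique_congr fun x => and_congr_right fun hx => ?_).2 main
  rw [funext_iff]
  refine forall_congr' fun i => ?_
  rw [← Complex.ofReal_inj, hre _ (hw x hx) i, eq_comm]

end Matrix

/-- For any fixed nonnegative `ḡ_1,…,ḡ_K`, the δ-system has a unique nonnegative
solution `(δ_{kj})`. -/
theorem delta_system_unique_solution
    (N K : ℕ) (hN : 0 < N) (hK : 0 < K)
    (Nk : Fin K → ℕ) (hNk : ∀ k, 0 < Nk k)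
    (R : (k : Fin K) → Fin (Nk k) → Matrix (Fin N) (Fin N) ℂ)
    (hRherm : ∀ k j, (R k j).IsHermitian) (hRpsd : ∀ k j, (R k j).PosSemidef)
    (ρ : ℝ) (hρ : 0 < ρ)
    (gbar : Fin K → ℝ) (hgbar : ∀ k, 0 ≤ gbar k) :
    ∃! δ : (k : Fin K) → Fin (Nk k) → ℝ,
      (∀ k j, 0 ≤ δ k j) ∧ DeltaSystem N K Nk R ρ gbar δ := by
  have main := Matrix.existsUnique_resolvent_fixedPoint
    (R := fun p : Σ k, Fin (Nk k) => R p.1 p.2) (fun p => hRpsd p.1 p.2)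
    (a := 1 / (N : ℝ)) (by positivity) hρ (g := fun p => gbar p.1) fun p => hgbar p.1
  refine (Equiv.piCurry fun (k : Fin K) (_ : Fin (Nk k)) => ℝ).existsUnique_congr ?_ |>.1 main
  intro x
  refine and_congr Sigma.forall ?_
  simp only [DeltaSystem, Matrix.regularizedSum, Sigma.forall, Fintype.sum_sigma,
    Equiv.piCurry_apply, Sigma.curry]
  norm_num
end

section
/- Let ρ > 0, let A be an N×N complex Hermitian positive semidefinite matrix, let B be an N×N complex Hermitian positive definite matrix, and let R be an N×N complex Hermitian positive semidefinite matrix that is not the zero matrix. Then for all reals ḡ > ḡ' ≥ 0: tr( R ( ḡ B + A + ρ I_N )^{-1} ) < tr( R ( ḡ' B + A + ρ I_N )^{-1} ); that is, the map ḡ ↦ tr( R ( ḡ B + A + ρ I_N )^{-1} ) is strictly decreasing on [0,∞). -/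
open Matrix
open scoped ComplexOrder

section

open scoped MatrixOrder

variable {𝕜 n : Type*} [RCLike 𝕜] [Fintype n] [DecidableEq n]

theorem Matrix.PosSemidef.exists_eq_conjTranspose_mul_self_s5 {R : Matrix n n 𝕜}
    (hR : R.PosSemidef) : ∃ S : Matrix n n 𝕜, R = Sᴴ * S :=
  CStarAlgebra.nonneg_iff_eq_star_mul_self.mp hR.nonneg

end

section

variable {𝕜 n : Type*} [RCLike 𝕜] [Fintype n] [DecidableEq n]

theorem Matrix.PosSemidef.trace_mul_pos_of_posDef {R M : Matrix n n 𝕜}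
    (hR : R.PosSemidef) (hR0 : R ≠ 0) (hM : M.PosDef) : 0 < (R * M).trace := by
  obtain ⟨S, rfl⟩ := hR.exists_eq_conjTranspose_mul_self_s5
  obtain ⟨C, hC⟩ := hM.posSemidef.exists_eq_conjTranspose_mul_self_s5
  have key : (Sᴴ * S * M).trace = ((S * Cᴴ) * (S * Cᴴ)ᴴ).trace := by
    rw [hC, Matrix.mul_assoc, Matrix.trace_mul_comm]
    simp [Matrix.mul_assoc]
  rw [key]
  refine lt_of_le_of_ne (posSemidef_self_mul_conjTranspose _).trace_nonneg fun h ↦ hR0 ?_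
  have hSC : S * Cᴴ = 0 := trace_mul_conjTranspose_self_eq_zero_iff.mp h.symm
  have hSM : S * M = 0 := by rw [hC, ← Matrix.mul_assoc, hSC, Matrix.zero_mul]
  rw [(hM.isUnit.mul_left_eq_zero).mp hSM, Matrix.mul_zero]

theorem Matrix.PosDef.inv_sub_inv_add {Y D : Matrix n n 𝕜} (hY : Y.PosDef) (hD : D.PosDef) :
    (Y⁻¹ - (Y + D)⁻¹).PosDef := by
  have hX : (Y + D).PosDef := hY.add hD
  have hYu := (isUnit_iff_isUnit_det _).mp hY.isUnit
  have hXu := (isUnit_iff_isUnit_det _).mp hX.isUnit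
  set X := Y + D with hXdef
  have hDX : D = X - Y := by simp [hXdef]
  have left : Y⁻¹ - X⁻¹ = X⁻¹ * D * Y⁻¹ := by
    rw [hDX, Matrix.mul_sub, nonsing_inv_mul _ hXu, Matrix.sub_mul, Matrix.one_mul,
      Matrix.mul_assoc, mul_nonsing_inv _ hYu, Matrix.mul_one]
  have right : Y⁻¹ - X⁻¹ = Y⁻¹ * D * X⁻¹ := by
    rw [hDX, Matrix.mul_sub, nonsing_inv_mul _ hYu, Matrix.sub_mul, Matrix.one_mul,
      Matrix.mul_assoc, mul_nonsing_inv _ hXu, Matrix.mul_one]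
  have key : Y⁻¹ - X⁻¹ = X⁻¹ * (D + D * Y⁻¹ * Dᴴ) * (X⁻¹)ᴴ := by
    rw [hX.inv.isHermitian.eq, hD.isHermitian.eq]
    calc Y⁻¹ - X⁻¹ = X⁻¹ * D * Y⁻¹ := left
      _ = X⁻¹ * D * (Y⁻¹ * D * X⁻¹ + X⁻¹) := by rw [← right, sub_add_cancel]
      _ = X⁻¹ * (D + D * Y⁻¹ * D) * X⁻¹ := by noncomm_ring
  rw [key]
  have hDYD := hY.inv.posSemidef.mul_mul_conjTranspose_same D
  exact (hD.add_posSemidef hDYD).mul_mul_conjTranspose_same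
    (vecMul_injective_iff_isUnit.mpr hX.inv.isUnit)

end

/-- The map `ḡ ↦ tr(R (ḡ B + A + ρ I_N)⁻¹)` is strictly decreasing on `[0,∞)`
when `B` is Hermitian positive definite, `A` is Hermitian positive semidefinite and
`R` is Hermitian positive semidefinite and nonzero. -/
theorem trace_resolvent_strict_anti
    (N : ℕ) (hN : 0 < N) (ρ : ℝ) (hρ : 0 < ρ)
    (A B R : Matrix (Fin N) (Fin N) ℂ)
    (hA : A.PosSemidef) (hB : B.PosDef) (hR : R.PosSemidef) (hRne : R ≠ 0)
    (gbar gbar' : ℝ) (hgt : gbar > gbar') (hge : 0 ≤ gbar') :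
    (R * ((gbar : ℂ) • B + A + (ρ : ℂ) • (1 : Matrix (Fin N) (Fin N) ℂ))⁻¹).trace <
      (R * ((gbar' : ℂ) • B + A + (ρ : ℂ) • (1 : Matrix (Fin N) (Fin N) ℂ))⁻¹).trace := by
  have hY : ((gbar' : ℂ) • B + A + (ρ : ℂ) • (1 : Matrix (Fin N) (Fin N) ℂ)).PosDef :=
    .posSemidef_add
      ((hB.posSemidef.smul (Complex.zero_le_real.mpr hge)).add hA)
      (PosDef.one.smul (Complex.zero_lt_real.mpr hρ))
  have hD : (((gbar - gbar' : ℝ) : ℂ) • B).PosDef :=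
    hB.smul (Complex.zero_lt_real.mpr (sub_pos.mpr hgt))
  have hX : (gbar : ℂ) • B + A + (ρ : ℂ) • (1 : Matrix (Fin N) (Fin N) ℂ) =
      ((gbar' : ℂ) • B + A + (ρ : ℂ) • 1) + ((gbar - gbar' : ℝ) : ℂ) • B := by
    rw [Complex.ofReal_sub]
    module
  rw [← sub_pos, ← trace_sub, ← Matrix.mul_sub, hX]
  exact hR.trace_mul_pos_of_posDef hRne (hY.inv_sub_inv_add hD)
end

section
/- Let ρ > 0, let A and B be N×N complex Hermitian positive semidefinite matrices, and let R be an N×N complex Hermitian positive semidefinite matrix that is not the zero matrix. Then for all reals ḡ > ḡ' > 0: ḡ · tr( R ( ḡ B + A + ρ I_N )^{-1} ) > ḡ' · tr( R ( ḡ' B + A + ρ I_N )^{-1} ); that is, the map ḡ ↦ ḡ · tr( R ( ḡ B + A + ρ I_N )^{-1} ) is strictly increasing on (0,∞). -/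
open Matrix
open scoped ComplexOrder

open scoped MatrixOrder Matrix.Norms.L2Operator in
/-- The trace of the product of a nonzero positive semidefinite matrix and a positive definite
matrix is positive. -/
theorem Matrix.PosSemidef.trace_mul_pos_s6 {n : Type*} [Fintype n] [DecidableEq n]
    {R M : Matrix n n ℂ} (hR : R.PosSemidef) (hRne : R ≠ 0) (hM : M.PosDef) :
    0 < (R * M).trace := by
  obtain ⟨S, rfl⟩ := CStarAlgebra.nonneg_iff_eq_star_mul_self.mp hR.nonneg
  obtain ⟨T, rfl⟩ := CStarAlgebra.nonneg_iff_eq_star_mul_self.mp hM.posSemidef.nonneg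
  have hT : IsUnit T := by
    rw [isUnit_iff_isUnit_det]
    have h := (isUnit_iff_isUnit_det _).mp hM.isUnit
    rw [det_mul] at h
    exact isUnit_of_mul_isUnit_right h
  have hST : (star S * S * (star T * T)).trace = ((T * Sᴴ)ᴴ * (T * Sᴴ)).trace := by
    rw [star_eq_conjTranspose, star_eq_conjTranspose, mul_assoc, trace_mul_comm]
    simp [mul_assoc]
  rw [hST]
  refine lt_of_le_of_ne (posSemidef_conjTranspose_mul_self _).trace_nonneg fun h ↦ hRne ?_
  have hS : star S = 0 :=
    hT.mul_right_eq_zero.mp (trace_conjTranspose_mul_self_eq_zero_iff.mp h.symm)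
  rw [hS, zero_mul]

/-- Inversion of positive definite matrices is strictly antitone. -/
theorem Matrix.PosDef.inv_sub_inv_add_s6 {n : Type*} [Fintype n] [DecidableEq n]
    {X D : Matrix n n ℂ} (hX : X.PosDef) (hD : D.PosDef) :
    (X⁻¹ - (X + D)⁻¹).PosDef := by
  have hY : (X + D).PosDef := hX.add hD
  have hX' := (isUnit_iff_isUnit_det _).mp hX.isUnit
  have hY' := (isUnit_iff_isUnit_det _).mp hY.isUnit
  have hU : ((X + D)⁻¹)ᴴ = (X + D)⁻¹ := hY.inv.isHermitian
  have left : X⁻¹ = (X + D)⁻¹ + (X + D)⁻¹ * D * X⁻¹ := by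
    have h : (X + D)⁻¹ * (X + D) * X⁻¹ = X⁻¹ := by rw [nonsing_inv_mul _ hY', one_mul]
    rw [mul_add, add_mul, mul_assoc, mul_nonsing_inv _ hX', mul_one] at h
    exact h.symm
  have right : X⁻¹ = (X + D)⁻¹ + X⁻¹ * D * (X + D)⁻¹ := by
    have h : X⁻¹ * (X + D) * (X + D)⁻¹ = X⁻¹ := by
      rw [mul_assoc, mul_nonsing_inv _ hY', mul_one]
    rw [mul_add, add_mul, nonsing_inv_mul _ hX', one_mul] at h
    exact h.symm
  have key : X⁻¹ - (X + D)⁻¹ = ((X + D)⁻¹)ᴴ * (D + Dᴴ * X⁻¹ * D) * (X + D)⁻¹ := by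
    rw [hU, hD.isHermitian]
    calc X⁻¹ - (X + D)⁻¹ = (X + D)⁻¹ * D * X⁻¹ := sub_eq_of_eq_add' left
      _ = (X + D)⁻¹ * D * ((X + D)⁻¹ + X⁻¹ * D * (X + D)⁻¹) := by rw [← right]
      _ = _ := by noncomm_ring
  rw [key]
  have h := hD.add_posSemidef (hX.inv.posSemidef.conjTranspose_mul_mul_same D)
  exact h.conjTranspose_mul_mul_same
    (mulVec_injective_of_isUnit hY.inv.isUnit)

/-- For `B` positive semidefinite and `C` positive definite, `g ↦ g (g B + C)⁻¹` is strictly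
increasing on `(0,∞)`. -/
theorem Matrix.PosDef.smul_inv_sub_smul_inv {n : Type*} [Fintype n] [DecidableEq n]
    {B C : Matrix n n ℂ} (hB : B.PosSemidef) (hC : C.PosDef) {g g' : ℝ} (hg' : 0 < g')
    (hg : g' < g) :
    ((g : ℂ) • ((g : ℂ) • B + C)⁻¹ - (g' : ℂ) • ((g' : ℂ) • B + C)⁻¹).PosDef := by
  have smul_inv : ∀ {a : ℝ}, 0 < a →
      (a : ℂ) • ((a : ℂ) • B + C)⁻¹ = (B + ((a⁻¹ : ℝ) : ℂ) • C)⁻¹ := by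
    intro a ha
    have ha' : (a : ℂ) ≠ 0 := by exact_mod_cast ha.ne'
    have hP : ((a : ℂ) • B + C).PosDef :=
      PosDef.posSemidef_add (hB.smul (by exact_mod_cast ha.le)) hC
    refine (inv_eq_right_inv ?_).symm
    have h : B + ((a⁻¹ : ℝ) : ℂ) • C = (a : ℂ)⁻¹ • ((a : ℂ) • B + C) := by
      rw [smul_add, inv_smul_smul₀ ha', Complex.ofReal_inv]
    rw [h, smul_mul_smul_comm, inv_mul_cancel₀ ha',
      mul_nonsing_inv _ ((isUnit_iff_isUnit_det _).mp hP.isUnit), one_smul]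
  have hpos : 0 < g := hg'.trans hg
  have hX : (B + ((g⁻¹ : ℝ) : ℂ) • C).PosDef :=
    PosDef.posSemidef_add hB (hC.smul (by exact_mod_cast inv_pos.mpr hpos))
  have hD : (((g'⁻¹ - g⁻¹ : ℝ) : ℂ) • C).PosDef :=
    hC.smul (by exact_mod_cast sub_pos.mpr (inv_strictAnti₀ hg' hg))
  have h := hX.inv_sub_inv_add_s6 hD
  rwa [add_assoc, ← add_smul, ← Complex.ofReal_add, add_sub_cancel, ← smul_inv hpos,
    ← smul_inv hg'] at h

/-- The map `ḡ ↦ ḡ · tr(R (ḡ B + A + ρ I_N)⁻¹)` is strictly increasing on `(0,∞)`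
when `A` and `B` are Hermitian positive semidefinite and `R` is Hermitian positive
semidefinite and nonzero. -/
theorem trace_resolvent_scaled_strict_mono
    (N : ℕ) (hN : 0 < N) (ρ : ℝ) (hρ : 0 < ρ)
    (A B R : Matrix (Fin N) (Fin N) ℂ)
    (hA : A.PosSemidef) (hB : B.PosSemidef) (hR : R.PosSemidef) (hRne : R ≠ 0)
    (gbar gbar' : ℝ) (hgt : gbar > gbar') (hge : 0 < gbar') :
    (gbar : ℂ) * (R * ((gbar : ℂ) • B + A + (ρ : ℂ) • (1 : Matrix (Fin N) (Fin N) ℂ))⁻¹).trace >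
      (gbar' : ℂ) * (R * ((gbar' : ℂ) • B + A + (ρ : ℂ) • (1 : Matrix (Fin N) (Fin N) ℂ))⁻¹).trace := by
  have hC : (A + (ρ : ℂ) • (1 : Matrix (Fin N) (Fin N) ℂ)).PosDef :=
    PosDef.posSemidef_add hA (PosDef.one.smul (by exact_mod_cast hρ))
  have h := hR.trace_mul_pos_s6 hRne (hC.smul_inv_sub_smul_inv hB hge hgt)
  rw [mul_sub, trace_sub, mul_smul_comm, mul_smul_comm, trace_smul, trace_smul, smul_eq_mul,
    smul_eq_mul, ← add_assoc, ← add_assoc] at h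
  exact sub_pos.mp h
end
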